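/- Let F be a field of characteristic zero, let f* = x^3 + 3x^2 + λ·x + λ ∈ F[x, λ] (the Weierstrass pencil x^3 + λx + 2 recentered at its singular point (1, −3)), and let P*_m ∈ F[x, λ] (m ≥ 1) be the atomic inflection polynomials attached to (f*, u) with u = 1/2. Then for every m ≥ 3, the convex hull in ℝ² of the support of P*_m equals the convex hull of the points (0, ⌈m/2⌉), (0, m), (m−2, 1), (2m−1, 0), (2m, 0), together with the additional point (1, (m−1)/2) when m is odd. -/

import Mathlib

open MvPolynomial

/-- The coefficient of `x ^ i * y ^ j`, extended by zero to integer exponents. -/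
noncomputable def intCoeff {F : Type*} [Field F] (p : MvPolynomial (Fin 2) F) (i j : ℤ) : F :=
  if 0 ≤ i ∧ 0 ≤ j then p.coeff (Finsupp.single 0 i.toNat + Finsupp.single 1 j.toNat) else 0

section intCoeff

variable {F : Type*} [Field F]

lemma intCoeff_of_neg (p : MvPolynomial (Fin 2) F) {i j : ℤ} (h : i < 0 ∨ j < 0) :
    intCoeff p i j = 0 := by
  unfold intCoeff
  rw [if_neg]
  omega

lemma intCoeff_add (p q : MvPolynomial (Fin 2) F) (i j : ℤ) :
    intCoeff (p + q) i j = intCoeff p i j + intCoeff q i j := by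
  unfold intCoeff
  split_ifs <;> simp

lemma intCoeff_C_mul (a : F) (p : MvPolynomial (Fin 2) F) (i j : ℤ) :
    intCoeff (C a * p) i j = a * intCoeff p i j := by
  unfold intCoeff
  split_ifs <;> simp

lemma intCoeff_natCast (p : MvPolynomial (Fin 2) F) (a b : ℕ) :
    intCoeff p a b = p.coeff (Finsupp.single 0 a + Finsupp.single 1 b) := by
  simp [intCoeff]

lemma intCoeff_eq_coeff (p : MvPolynomial (Fin 2) F) (d : Fin 2 →₀ ℕ) :
    intCoeff p (d 0) (d 1) = p.coeff d := by
  rw [intCoeff_natCast]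
  congr 1
  ext k
  fin_cases k <;> simp

lemma intCoeff_monomial (d : Fin 2 →₀ ℕ) (a : F) (i j : ℤ) :
    intCoeff (monomial d a) i j = if (d 0 : ℤ) = i ∧ (d 1 : ℤ) = j then a else 0 := by
  by_cases h : 0 ≤ i ∧ 0 ≤ j
  · obtain ⟨⟨a, rfl⟩, b, rfl⟩ := h.imp Int.eq_ofNat_of_zero_le Int.eq_ofNat_of_zero_le
    rw [intCoeff_natCast, coeff_monomial]
    refine if_congr ?_ rfl rfl
    rw [Finsupp.ext_iff, Fin.forall_fin_two]
    simp
  · rw [intCoeff_of_neg _ (by omega), if_neg (by omega)]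

lemma intCoeff_X_zero_mul (p : MvPolynomial (Fin 2) F) (i j : ℤ) :
    intCoeff (X 0 * p) i j = intCoeff p (i - 1) j := by
  induction p using MvPolynomial.induction_on' with
  | monomial d a =>
    rw [X, monomial_mul, intCoeff_monomial, intCoeff_monomial, one_mul]
    refine if_congr ?_ rfl rfl
    simp
    omega
  | add p q hp hq => rw [mul_add, intCoeff_add, hp, hq, intCoeff_add]

lemma intCoeff_X_one_mul (p : MvPolynomial (Fin 2) F) (i j : ℤ) :
    intCoeff (X 1 * p) i j = intCoeff p i (j - 1) := by
  induction p using MvPolynomial.induction_on' with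
  | monomial d a =>
    rw [X, monomial_mul, intCoeff_monomial, intCoeff_monomial, one_mul]
    refine if_congr ?_ rfl rfl
    simp
    omega
  | add p q hp hq => rw [mul_add, intCoeff_add, hp, hq, intCoeff_add]

lemma intCoeff_pderiv_zero (p : MvPolynomial (Fin 2) F) (i j : ℤ) :
    intCoeff (pderiv 0 p) i j = (i + 1) * intCoeff p (i + 1) j := by
  by_cases h : 0 ≤ i ∧ 0 ≤ j
  · obtain ⟨⟨a, rfl⟩, b, rfl⟩ := h.imp Int.eq_ofNat_of_zero_le Int.eq_ofNat_of_zero_le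
    rw [intCoeff_natCast, coeff_pderiv, ← Nat.cast_succ a, intCoeff_natCast, add_right_comm,
      ← Finsupp.single_add, mul_comm]
    simp
  · rw [intCoeff_of_neg _ (by omega)]
    rcases eq_or_ne i (-1) with rfl | hi
    · simp
    · rw [intCoeff_of_neg _ (by omega), mul_zero]

end intCoeff

lemma pderiv_zero_weierstrass {F : Type*} [Field F] {f : MvPolynomial (Fin 2) F}
    (hf : f = X 0 ^ 3 + 3 * X 0 ^ 2 + X 1 * X 0 + X 1) :
    pderiv 0 f = C 3 * X 0 ^ 2 + C 6 * X 0 + X 1 := by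
  subst hf
  rw [map_ofNat, map_ofNat,
    show (3 : MvPolynomial (Fin 2) F) = ((3 : ℕ) : MvPolynomial (Fin 2) F) by norm_num]
  simp only [map_add, Derivation.leibniz, Derivation.leibniz_pow, Derivation.map_natCast,
    pderiv_X_self, pderiv_X_of_ne (zero_ne_one' (Fin 2)).symm, smul_eq_mul, nsmul_eq_mul]
  push_cast
  ring

/-- The recursion defining the atomic inflection polynomials of the recentered pencil, read off on
coefficients. -/
lemma intCoeff_atomic_succ {F : Type*} [Field F] {p q f : MvPolynomial (Fin 2) F} {m : ℕ}
    (hf : f = X 0 ^ 3 + 3 * X 0 ^ 2 + X 1 * X 0 + X 1)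
    (h : C ((m : F) + 1) * q =
      pderiv 0 p * f + C ((1 / 2 : F) - (m : F)) * (p * pderiv 0 f)) (i j : ℤ) :
    ((m : F) + 1) * intCoeff q i j =
      (i - 2 + 3 * (1 / 2 - m)) * intCoeff p (i - 2) j
      + (3 * (i - 1) + 6 * (1 / 2 - m)) * intCoeff p (i - 1) j
      + (i + (1 / 2 - m)) * intCoeff p i (j - 1)
      + (i + 1) * intCoeff p (i + 1) (j - 1) := by
  have e : pderiv 0 p * f + C ((1 / 2 : F) - (m : F)) * (p * pderiv 0 f) =
      X 0 * (X 0 * (X 0 * pderiv 0 p)) + C 3 * (X 0 * (X 0 * pderiv 0 p))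
      + X 1 * (X 0 * pderiv 0 p) + X 1 * pderiv 0 p
      + C ((1 / 2 : F) - (m : F)) *
        (C 3 * (X 0 * (X 0 * p)) + C 6 * (X 0 * p) + X 1 * p) := by
    rw [pderiv_zero_weierstrass hf, hf, map_ofNat]
    ring
  have := congrArg (intCoeff · i j) (h.trans e)
  simp only [intCoeff_add, intCoeff_C_mul, intCoeff_X_zero_mul, intCoeff_X_one_mul,
    intCoeff_pderiv_zero] at this
  rw [this]
  have e1 : i - 1 - 1 = i - 2 := by ring
  have e2 : i - 1 - 1 - 1 + 1 = i - 2 := by ring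
  have e3 : i - 1 - 1 + 1 = i - 1 := by ring
  have e4 : i - 1 + 1 = i := by ring
  rw [e2, e3, e4, e1]
  push_cast
  ring

/-- The derivative of an atomic inflection polynomial with exponent `1 / 2` for a monic cubic `f`
is a combination of the two preceding ones. -/
lemma Derivation.atomic_eq {A R : Type*} [CommRing A] [CommRing R] [IsDomain R] [CharZero R]
    [Algebra A R] (D : Derivation A R R) {f f₁ f₂ : R} {P : ℕ → R}
    (h₁ : D f = f₁) (h₂ : D f₁ = 2 * f₂) (h₃ : D f₂ = 3) (h0 : P 0 = 1)
    (hP : ∀ m : ℕ, 2 * ((m : R) + 1) * P (m + 1) = 2 * (D (P m) * f) + (1 - 2 * m) * (P m * f₁))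
    (m : ℕ) :
    2 * D (P (m + 2)) = -(2 * m) * (f₂ * P (m + 1)) + (3 - 2 * m) * (f * P m) := by
  have D2 : D 2 = 0 := D.map_natCast 2
  have D3 : D 3 = 0 := D.map_natCast 3
  induction m with
  | zero =>
    have a0 := hP 0
    have a1 := hP 1
    simp only [h0, Nat.cast_zero, Nat.cast_one, zero_add, D.map_one_eq_zero] at a0 a1 ⊢
    have d0 := congrArg D a0
    have d1 := congrArg D a1
    simp only [D.leibniz, map_add, map_sub, map_zero, D.map_one_eq_zero, h₁, h₂, D2,
      smul_eq_mul] at d0 d1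
    have e0 := congrArg D d0
    simp only [D.leibniz, map_add, map_sub, map_zero, D.map_one_eq_zero, h₁, h₂, h₃, D2,
      smul_eq_mul] at e0
    apply mul_left_cancel₀ (show (4 : R) ≠ 0 by norm_num)
    linear_combination 2 * d1 + 2 * f * e0 + f₁ * d0 - 2 * f₂ * a0
  | succ m ih =>
    have a0 := hP m
    have a1 := hP (m + 1)
    have d2 := congrArg D (hP (m + 2))
    have e := congrArg D ih
    simp only [D.leibniz, map_add, map_sub, map_neg, D.map_one_eq_zero, D.map_natCast,
      h₁, h₂, h₃, D2, D3, smul_eq_mul, Nat.cast_add, Nat.cast_one, Nat.cast_ofNat] at a0 a1 d2 e ⊢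
    have hm : (2 * ((m : R) + 3)) ≠ 0 :=
      mul_ne_zero two_ne_zero (by exact_mod_cast Nat.succ_ne_zero (m + 2))
    apply mul_left_cancel₀ hm
    linear_combination 2 * d2 + 2 * f * e + (-1 - 2 * m) * f₁ * ih + 2 * m * f₂ * a1
      + (2 * m - 3) * f * a0

/-- The derivative relation for the recentered pencil, read off on the coefficients of `x`. -/
lemma intCoeff_atomic_one {F : Type*} [Field F] [CharZero F] {f : MvPolynomial (Fin 2) F}
    (hf : f = X 0 ^ 3 + 3 * X 0 ^ 2 + X 1 * X 0 + X 1)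
    {P : ℕ → MvPolynomial (Fin 2) F} (h0 : P 0 = 1)
    (hP : ∀ m : ℕ, C ((m : F) + 1) * P (m + 1) =
        pderiv 0 (P m) * f + C ((1 / 2 : F) - (m : F)) * (P m * pderiv 0 f)) (m : ℕ) (j : ℤ) :
    2 * intCoeff (P (m + 2)) 1 j =
      -(6 * m) * intCoeff (P (m + 1)) 0 j + (3 - 2 * m) * intCoeff (P m) 0 (j - 1) := by
  have h₁ := pderiv_zero_weierstrass hf
  have h₂ : pderiv 0 (C 3 * X 0 ^ 2 + C 6 * X 0 + X 1 : MvPolynomial (Fin 2) F)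
      = 2 * (C 3 * X 0 + C 3) := by
    simp only [map_add, Derivation.leibniz, Derivation.leibniz_pow, pderiv_C,
      pderiv_X_self, pderiv_X_of_ne (zero_ne_one' (Fin 2)).symm, smul_eq_mul, nsmul_eq_mul]
    rw [map_ofNat, map_ofNat]
    push_cast
    ring
  have h₃ : pderiv 0 (C 3 * X 0 + C 3 : MvPolynomial (Fin 2) F) = 3 := by
    simp only [map_add, Derivation.leibniz, pderiv_C, pderiv_X_self, smul_eq_mul]
    rw [map_ofNat]
    ring
  have hP' (m : ℕ) : 2 * ((m : MvPolynomial (Fin 2) F) + 1) * P (m + 1) =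
      2 * (pderiv 0 (P m) * f) +
        (1 - 2 * (m : MvPolynomial (Fin 2) F)) * (P m * (C 3 * X 0 ^ 2 + C 6 * X 0 + X 1)) := by
    have hc : (2 : MvPolynomial (Fin 2) F) * C (1 / 2) = 1 := by
      rw [← map_ofNat C, ← C_mul]
      simp
    have := hP m
    rw [h₁, map_add, map_sub, map_natCast, map_one] at this
    linear_combination 2 * this + P m * (C 3 * X 0 ^ 2 + C 6 * X 0 + X 1) * hc
  have key := Derivation.atomic_eq (pderiv 0) h₁ h₂ h₃ h0 hP' m
  have e : C 2 * pderiv 0 (P (m + 2)) =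
      C (-(6 * m : F)) * (X 0 * P (m + 1)) + C (-(6 * m : F)) * P (m + 1) + C (3 - 2 * m : F) *
        (X 0 * (X 0 * (X 0 * P m)) + C 3 * (X 0 * (X 0 * P m)) + X 0 * (X 1 * P m) + X 1 * P m) := by
    rw [hf] at key
    simp only [map_neg, map_mul, map_sub, map_natCast, map_ofNat] at key ⊢
    linear_combination key
  have := congrArg (intCoeff · 0 j) e
  simp only [intCoeff_add, intCoeff_C_mul, intCoeff_X_zero_mul, intCoeff_X_one_mul,
    intCoeff_pderiv_zero] at this
  simpa [intCoeff_of_neg] using this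

/-- The recursions satisfied by the coefficients of the atomic inflection polynomials of the
recentered Weierstrass pencil, with exponent `1 / 2`. -/
structure IsAtomicArray {F : Type*} [Field F] (a : ℕ → ℤ → ℤ → F) : Prop where
  zero : ∀ i j, a 0 i j = if i = 0 ∧ j = 0 then 1 else 0
  neg : ∀ m i j, i < 0 ∨ j < 0 → a m i j = 0
  succ : ∀ (m : ℕ) (i j : ℤ), ((m : F) + 1) * a (m + 1) i j =
    (i - 2 + 3 * (1 / 2 - m)) * a m (i - 2) j
    + (3 * (i - 1) + 6 * (1 / 2 - m)) * a m (i - 1) j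
    + (i + (1 / 2 - m)) * a m i (j - 1) + (i + 1) * a m (i + 1) (j - 1)
  one : ∀ (m : ℕ) (j : ℤ),
    2 * a (m + 2) 1 j = -(6 * m) * a (m + 1) 0 j + (3 - 2 * m) * a m 0 (j - 1)

lemma two_mul_add_one_sub_two_mul_ne_zero {F : Type*} [Field F] [CharZero F] (p q : ℤ) :
    (2 * p + 1 - 2 * q : F) ≠ 0 := by
  have : (2 * p + 1 - 2 * q : ℤ) ≠ 0 := by omega
  exact_mod_cast this

namespace IsAtomicArray

variable {F : Type*} [Field F] [CharZero F] {a : ℕ → ℤ → ℤ → F} (h : IsAtomicArray a)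

include h

lemma eq_zero (m : ℕ) : ∀ i j : ℤ,
    i + 2 * j < m ∨ 2 * m < i + 2 * j ∨ (j = 0 ∧ i < 2 * m - 1) → a m i j = 0 := by
  induction m with
  | zero =>
    intro i j hij
    rcases lt_or_ge i 0 with hi | hi
    · exact h.neg _ _ _ (Or.inl hi)
    rw [h.zero, if_neg]
    push_cast at hij
    omega
  | succ m ih =>
    intro i j hij
    have hm : (m : F) + 1 ≠ 0 := Nat.cast_add_one_ne_zero m
    rw [← mul_right_inj' hm, h.succ, mul_zero]
    push_cast at hij
    rcases lt_or_ge i 0 with hi | hi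
    · rw [h.neg _ (i - 2) _ (by omega), h.neg _ (i - 1) _ (by omega), h.neg _ i _ (by omega)]
      rcases eq_or_ne i (-1) with rfl | hi
      · simp
      · rw [h.neg _ (i + 1) _ (by omega)]
        simp
    have h3 : a m i (j - 1) = 0 := by
      by_cases hj : j ≤ 0
      · exact h.neg _ _ _ (by omega)
      · exact ih _ _ (by omega)
    have h4 : a m (i + 1) (j - 1) = 0 := by
      by_cases hj : j ≤ 0
      · exact h.neg _ _ _ (by omega)
      · exact ih _ _ (by omega)
    rw [ih (i - 2) j (by omega), h3, h4]
    by_cases hi : j = 0 ∧ i = 2 * m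
    · obtain ⟨rfl, rfl⟩ := hi
      push_cast
      ring
    · rw [ih (i - 1) j (by omega)]
      simp

lemma bottom_row (m : ℕ) :
    a m (2 * m) 0 ≠ 0 ∧ a m (2 * m - 1) 0 = 2 * m * a m (2 * m) 0 := by
  induction m with
  | zero => simp [h.zero]
  | succ m ih =>
    have hm : (m : F) + 1 ≠ 0 := Nat.cast_add_one_ne_zero m
    have e1 : ((m : F) + 1) * a (m + 1) (2 * (m + 1)) 0 = (3 / 2 - m) * a m (2 * m) 0 := by
      rw [h.succ, h.eq_zero m (2 * (m + 1) - 1) 0 (by omega), h.neg m _ (0 - 1) (by omega),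
        h.neg m _ (0 - 1) (by omega), show 2 * ((m : ℤ) + 1) - 2 = 2 * m by ring]
      push_cast
      ring
    have e2 : ((m : F) + 1) * a (m + 1) (2 * (m + 1) - 1) 0 =
        (1 / 2 - m) * a m (2 * m - 1) 0 + 3 * a m (2 * m) 0 := by
      rw [h.succ, h.neg m _ (0 - 1) (by omega), h.neg m _ (0 - 1) (by omega),
        show 2 * ((m : ℤ) + 1) - 1 - 2 = 2 * m - 1 by ring,
        show 2 * ((m : ℤ) + 1) - 1 - 1 = 2 * m by ring]
      push_cast
      ring
    push_cast
    constructor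
    · intro h0
      rw [h0, mul_zero, eq_comm, mul_eq_zero] at e1
      refine e1.elim (fun h' => two_mul_add_one_sub_two_mul_ne_zero (F := F) 1 m ?_) ih.1
      push_cast
      linear_combination 2 * h'
    · apply mul_left_cancel₀ hm
      rw [e2, ih.2]
      linear_combination (-2 * (m + 1)) * e1

lemma top_ne_zero (m : ℕ) : a m 0 m ≠ 0 := by
  induction m with
  | zero => simp [h.zero]
  | succ m ih =>
    have e : ((m : F) + 1) * a (m + 1) 0 (m + 1) = (1 / 2 - m) * a m 0 m := by
      rw [h.succ, h.neg m (0 - 2) _ (by omega), h.neg m (0 - 1) _ (by omega),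
        h.eq_zero m (0 + 1) _ (by omega), add_sub_cancel_right]
      push_cast
      ring
    intro h0
    push_cast at h0
    rw [h0, mul_zero, eq_comm, mul_eq_zero] at e
    refine e.elim (fun h' => two_mul_add_one_sub_two_mul_ne_zero (F := F) 0 m ?_) ih
    push_cast
    linear_combination 2 * h'

lemma odd_one (n : ℕ) : a (2 * n + 1) 1 n = 3 * (1 - 2 * n) * a (2 * n) 0 n := by
  rcases n with _ | n
  · have e := h.succ 0 1 0
    simp [h.zero] at e
    simp [h.zero, e]
    norm_num
  · have e := h.one (2 * n + 1) (n + 1)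
    rw [add_sub_cancel_right, h.eq_zero (2 * n + 1) 0 n (by push_cast; omega)] at e
    apply mul_left_cancel₀ (two_ne_zero (α := F))
    push_cast at e ⊢
    rw [show 2 * (n + 1) + 1 = 2 * n + 1 + 2 by ring, e, show 2 * (n + 1) = 2 * n + 1 + 1 by ring]
    ring

lemma even_zero_succ (n : ℕ) :
    (2 * n + 2) * a (2 * (n + 1)) 0 (n + 1) = 3 * (1 - 2 * n) * a (2 * n) 0 n := by
  have e := h.succ (2 * n + 1) 0 (n + 1)
  rw [h.neg _ (0 - 2) _ (by omega), h.neg _ (0 - 1) _ (by omega), add_sub_cancel_right, zero_add,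
    h.odd_one, h.eq_zero _ 0 n (by push_cast; omega)] at e
  push_cast at e
  rw [show 2 * (n + 1) = 2 * n + 1 + 1 by ring]
  linear_combination e

lemma even_zero_ne_zero (n : ℕ) : a (2 * n) 0 n ≠ 0 := by
  induction n with
  | zero => simp [h.zero]
  | succ n ih =>
    intro h0
    have e := h.even_zero_succ n
    push_cast at h0
    rw [h0, mul_zero, eq_comm] at e
    have := two_mul_add_one_sub_two_mul_ne_zero (F := F) 0 n
    refine mul_ne_zero (mul_ne_zero three_ne_zero ?_) ih e
    simpa using this

lemma odd_one_ne_zero (n : ℕ) : a (2 * n + 1) 1 n ≠ 0 := by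
  rw [h.odd_one]
  have := two_mul_add_one_sub_two_mul_ne_zero (F := F) 0 n
  refine mul_ne_zero (mul_ne_zero three_ne_zero ?_) (h.even_zero_ne_zero n)
  simpa using this

lemma odd_zero (n : ℕ) :
    a (2 * n + 1) 0 (n + 1) = (1 / 2 - 2 * n / 3) * a (2 * n) 0 n := by
  induction n with
  | zero =>
    have e := h.succ 0 0 1
    simp [h.zero] at e
    simp [h.zero, e]
  | succ n ih =>
    have hm : (2 * n + 3 : F) ≠ 0 := by exact_mod_cast Nat.succ_ne_zero (2 * n + 2)
    have e := h.succ (2 * (n + 1)) 0 (n + 1 + 1)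
    have e1 := h.one (2 * n) (n + 1)
    have e2 := h.even_zero_succ n
    rw [h.neg _ (0 - 2) _ (by omega), h.neg _ (0 - 1) _ (by omega), add_sub_cancel_right,
      zero_add] at e
    rw [add_sub_cancel_right, ih] at e1
    apply mul_left_cancel₀ hm
    rw [show 2 * n + 2 = 2 * (n + 1) by ring] at e1
    push_cast at e e1 e2 ⊢
    linear_combination e + e1 / 2 - (1 / 2 - 2 * n / 3) * e2

lemma odd_zero_ne_zero (n : ℕ) : a (2 * n + 1) 0 (n + 1) ≠ 0 := by
  rw [h.odd_zero]
  refine mul_ne_zero (fun h0 => two_mul_add_one_sub_two_mul_ne_zero (F := F) 1 (2 * n) ?_)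
    (h.even_zero_ne_zero n)
  push_cast
  linear_combination 6 * h0

lemma row_one_ne_zero (m : ℕ) : a (m + 2) m 1 ≠ 0 := by
  induction m with
  | zero => simpa using h.even_zero_ne_zero 1
  | succ m ih =>
    have hm : (m : F) + 3 ≠ 0 := by exact_mod_cast Nat.succ_ne_zero (m + 2)
    have e := h.succ (m + 2) (m + 1) 1
    rw [h.eq_zero (m + 2) (m + 1 - 2) 1 (by omega), sub_self,
      h.eq_zero (m + 2) (m + 1) 0 (by omega), h.eq_zero (m + 2) (m + 1 + 1) 0 (by omega),
      add_sub_cancel_right] at e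
    push_cast at e ⊢
    intro h0
    rw [show m + 1 + 2 = m + 2 + 1 by ring] at h0
    rw [h0] at e
    exact mul_ne_zero (mul_ne_zero three_ne_zero hm) ih (by linear_combination e)

end IsAtomicArray

lemma Convex.mem_of_weights {S : Set (ℝ × ℝ)} (hS : Convex ℝ S) {x₁ y₁ x₂ y₂ x y s t : ℝ}
    (h₁ : (x₁, y₁) ∈ S) (h₂ : (x₂, y₂) ∈ S) (hs : 0 ≤ s) (ht : 0 ≤ t) (hst : 0 < s + t)
    (hx : (s + t) * x = s * x₁ + t * x₂) (hy : (s + t) * y = s * y₁ + t * y₂) : (x, y) ∈ S := by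
  convert hS h₁ h₂ (div_nonneg hs hst.le) (div_nonneg ht hst.le) (by field_simp) using 1
  ext
  · simp
    field_simp
    linarith
  · simp
    field_simp
    linarith

/-- A convex set containing the listed vertices contains all the lattice points allowed by the
vanishing of the coefficients. -/
lemma Convex.mem_newton_polygon {S : Set (ℝ × ℝ)} (hS : Convex ℝ S) {m : ℕ} (hm : 3 ≤ m)
    (h₁ : ((0 : ℝ), (((m + 1) / 2 : ℕ) : ℝ)) ∈ S) (h₂ : ((0 : ℝ), (m : ℝ)) ∈ S)
    (h₃ : (((m - 2 : ℕ) : ℝ), (1 : ℝ)) ∈ S) (h₄ : (((2 * m - 1 : ℕ) : ℝ), (0 : ℝ)) ∈ S)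
    (h₅ : (((2 * m : ℕ) : ℝ), (0 : ℝ)) ∈ S)
    (h₆ : Odd m → ((1 : ℝ), (((m - 1) / 2 : ℕ) : ℝ)) ∈ S) {i j : ℕ}
    (hlow : m ≤ i + 2 * j) (hupp : i + 2 * j ≤ 2 * m) (hrow : j = 0 → 2 * m - 1 ≤ i) :
    ((i : ℝ), (j : ℝ)) ∈ S := by
  have hm' : (3 : ℝ) ≤ m := by exact_mod_cast hm
  rcases Nat.eq_zero_or_pos j with rfl | hj
  · obtain rfl | rfl : i = 2 * m - 1 ∨ i = 2 * m := by omega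
    · simpa using h₄
    · simpa using h₅
  have hj' : (1 : ℝ) ≤ j := by exact_mod_cast hj
  have hjm : (j : ℝ) ≤ m := by exact_mod_cast (by omega : j ≤ m)
  have hlow' : (m : ℝ) ≤ i + 2 * j := by exact_mod_cast hlow
  have hupp' : (i : ℝ) + 2 * j ≤ 2 * m := by exact_mod_cast hupp
  have hright : ((2 * m - 2 * j : ℝ), (j : ℝ)) ∈ S := by
    refine hS.mem_of_weights h₅ h₂ (s := m - j) (t := j) (by linarith) (by linarith)
      (by linarith) ?_ ?_ <;> push_cast <;> ring
  suffices hleft : ∃ x : ℝ, x ≤ i ∧ (x, (j : ℝ)) ∈ S by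
    obtain ⟨x, hx, hxS⟩ := hleft
    rcases hx.eq_or_lt with rfl | hx
    · exact hxS
    · exact hS.mem_of_weights hxS hright (s := 2 * m - 2 * j - i) (t := i - x) (by linarith)
        (by linarith) (by linarith) (by ring) (by ring)
  rcases le_or_gt m (2 * j) with hmj | hmj
  · refine ⟨0, by positivity, ?_⟩
    have h1 : (((m + 1) / 2 : ℕ) : ℝ) ≤ j := by exact_mod_cast (by omega : (m + 1) / 2 ≤ j)
    have h2 : (((m + 1) / 2 : ℕ) : ℝ) < m := by exact_mod_cast (by omega : (m + 1) / 2 < m)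
    exact hS.mem_of_weights h₁ h₂ (s := m - j) (t := j - ((m + 1) / 2 : ℕ)) (by linarith)
      (by linarith) (by linarith) (by ring) (by ring)
  · refine ⟨m - 2 * j, by linarith, ?_⟩
    have hcast : ((m - 2 : ℕ) : ℝ) = m - 2 := by
      push_cast [Nat.cast_sub (by omega : 2 ≤ m)]
      ring
    rw [hcast] at h₃
    rcases Nat.eq_or_lt_of_le hj with rfl | hj1
    · simpa using h₃
    have hj1' : (1 : ℝ) < j := by exact_mod_cast hj1
    obtain ⟨n, rfl | rfl⟩ := m.even_or_odd'
    · rw [show (2 * n + 1) / 2 = n by omega] at h₁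
      have hjn : (j : ℝ) ≤ n := by exact_mod_cast (by omega : j ≤ n)
      push_cast at h₃ ⊢
      exact hS.mem_of_weights h₃ h₁ (s := n - j) (t := j - 1) (by linarith) (by linarith)
        (by linarith) (by ring) (by ring)
    · have h₇ := h₆ (odd_two_mul_add_one n)
      rw [show (2 * n + 1 - 1) / 2 = n by omega] at h₇
      have hjn : (j : ℝ) ≤ n := by exact_mod_cast (by omega : j ≤ n)
      push_cast at h₃ ⊢
      exact hS.mem_of_weights h₃ h₇ (s := n - j) (t := j - 1) (by linarith) (by linarith)
        (by linarith) (by ring) (by ring)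

lemma isAtomicArray_intCoeff {F : Type*} [Field F] [CharZero F] {f : MvPolynomial (Fin 2) F}
    (hf : f = X 0 ^ 3 + 3 * X 0 ^ 2 + X 1 * X 0 + X 1)
    {P : ℕ → MvPolynomial (Fin 2) F} (h0 : P 0 = 1)
    (hP : ∀ m : ℕ, C ((m : F) + 1) * P (m + 1) =
        pderiv 0 (P m) * f + C ((1 / 2 : F) - (m : F)) * (P m * pderiv 0 f)) :
    IsAtomicArray fun m => intCoeff (P m) where
  zero i j := by
    rw [h0, ← C_1, C_apply, intCoeff_monomial]
    simp [eq_comm]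
  neg m i j := intCoeff_of_neg _
  succ m := intCoeff_atomic_succ hf (hP m)
  one := intCoeff_atomic_one hf h0 hP

lemma mem_image_support {F : Type*} [Field F] {p : MvPolynomial (Fin 2) F} {i j : ℕ}
    (h : intCoeff p i j ≠ 0) :
    ((i : ℝ), (j : ℝ)) ∈ (fun d : Fin 2 →₀ ℕ => (((d 0 : ℕ) : ℝ), ((d 1 : ℕ) : ℝ))) ''
      (p.support : Set (Fin 2 →₀ ℕ)) := by
  refine ⟨Finsupp.single 0 i + Finsupp.single 1 j, ?_, by simp⟩
  rwa [Finset.mem_coe, mem_support_iff, ← intCoeff_natCast]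

/-- For `u = 1/2` and `m ≥ 3`, the Newton polygon of the atomic
inflection polynomial `P*_m` of the recentered Weierstrass pencil
`y^n = x^3 + 3x^2 + λx + λ` is the convex hull of `(0, ⌈m/2⌉)`, `(0, m)`, `(m-2, 1)`,
`(2m-1, 0)`, `(2m, 0)`, together with `(1, (m-1)/2)` when `m` is odd. -/
theorem weierstrass_inflection_newton_polygon
    (F : Type*) [Field F] [CharZero F]
    (f : MvPolynomial (Fin 2) F)
    (hf : f = X 0 ^ 3 + 3 * X 0 ^ 2 + X 1 * X 0 + X 1)
    (P : ℕ → MvPolynomial (Fin 2) F)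
    (hP1 : P 1 = C (1 / 2 : F) * pderiv 0 f)
    (hPrec : ∀ m : ℕ, 1 ≤ m →
      C ((m : F) + 1) * P (m + 1) =
        pderiv 0 (P m) * f + C ((1 / 2 : F) - (m : F)) * (P m * pderiv 0 f)) :
    ∀ m : ℕ, 3 ≤ m →
      convexHull ℝ
        ((fun d : Fin 2 →₀ ℕ => (((d 0 : ℕ) : ℝ), ((d 1 : ℕ) : ℝ))) ''
          ((P m).support : Set (Fin 2 →₀ ℕ))) =
      convexHull ℝ
        (({((0 : ℝ), (((m + 1) / 2 : ℕ) : ℝ)),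
           ((0 : ℝ), (m : ℝ)),
           (((m - 2 : ℕ) : ℝ), (1 : ℝ)),
           (((2 * m - 1 : ℕ) : ℝ), (0 : ℝ)),
           (((2 * m : ℕ) : ℝ), (0 : ℝ))} : Set (ℝ × ℝ)) ∪
         (if Odd m then ({((1 : ℝ), (((m - 1) / 2 : ℕ) : ℝ))} : Set (ℝ × ℝ)) else ∅)) := by
  intro m hm
  set Q : ℕ → MvPolynomial (Fin 2) F := fun n => if n = 0 then 1 else P n with hQ
  have hQP : Q m = P m := if_neg (by omega)
  have h : IsAtomicArray fun m => intCoeff (Q m) := by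
    refine isAtomicArray_intCoeff hf (if_pos rfl) fun n => ?_
    rcases Nat.eq_zero_or_pos n with rfl | hn
    · simp [hQ, hP1]
    · simpa [hQ, hn.ne'] using hPrec n hn
  rw [← hQP]
  apply subset_antisymm
  · refine convexHull_min ?_ (convex_convexHull ℝ _)
    rintro _ ⟨d, hd, rfl⟩
    rw [Finset.mem_coe, mem_support_iff, ← intCoeff_eq_coeff] at hd
    have hd' := mt (h.eq_zero m (d 0) (d 1)) hd
    have hsub := subset_convexHull ℝ
      (({((0 : ℝ), (((m + 1) / 2 : ℕ) : ℝ)),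
           ((0 : ℝ), (m : ℝ)),
           (((m - 2 : ℕ) : ℝ), (1 : ℝ)),
           (((2 * m - 1 : ℕ) : ℝ), (0 : ℝ)),
           (((2 * m : ℕ) : ℝ), (0 : ℝ))} : Set (ℝ × ℝ)) ∪
         (if Odd m then ({((1 : ℝ), (((m - 1) / 2 : ℕ) : ℝ))} : Set (ℝ × ℝ)) else ∅))
    refine (convex_convexHull ℝ _).mem_newton_polygon hm (hsub ?_) (hsub ?_) (hsub ?_) (hsub ?_)
      (hsub ?_) (fun ho => hsub ?_) ?_ ?_ ?_
    · simp
    · simp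
    · simp
    · simp
    · simp
    · rw [if_pos ho]
      simp
    · omega
    · omega
    · omega
  · refine convexHull_min (Set.Subset.trans ?_ (subset_convexHull ℝ _)) (convex_convexHull ℝ _)
    have htop := mem_image_support (i := 0) (by simpa using h.top_ne_zero m)
    have hrow := mem_image_support (i := m - 2) (j := 1) (p := Q m) (by
      simpa [Nat.sub_add_cancel (by omega : 2 ≤ m)] using h.row_one_ne_zero (m - 2))
    have hbot := mem_image_support (i := 2 * m) (j := 0) (p := Q m) (by
      simpa using (h.bottom_row m).1)
    have hbot' := mem_image_support (i := 2 * m - 1) (j := 0) (p := Q m) (by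
      have hb := h.bottom_row m
      rw [Nat.cast_sub (by omega)]
      push_cast
      rw [hb.2]
      refine mul_ne_zero (mul_ne_zero two_ne_zero ?_) hb.1
      exact_mod_cast (by omega : m ≠ 0))
    have hleft := mem_image_support (i := 0) (j := (m + 1) / 2) (p := Q m) (by
      obtain ⟨n, rfl | rfl⟩ := m.even_or_odd'
      · rw [show (2 * n + 1) / 2 = n by omega]
        exact h.even_zero_ne_zero n
      · rw [show (2 * n + 1 + 1) / 2 = n + 1 by omega]
        exact h.odd_zero_ne_zero n)
    have hodd (ho : Odd m) := mem_image_support (i := 1) (j := (m - 1) / 2) (p := Q m) (by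
      obtain ⟨n, rfl⟩ := ho
      rw [show (2 * n + 1 - 1) / 2 = n by omega]
      exact h.odd_one_ne_zero n)
    rw [Nat.cast_zero] at htop hbot hbot' hleft
    rw [Nat.cast_one] at hrow hodd
    rintro x (hx | hx)
    · simp only [Set.mem_insert_iff, Set.mem_singleton_iff] at hx
      rcases hx with rfl | rfl | rfl | rfl | rfl <;> assumption
    · split_ifs at hx with ho
      · rw [Set.mem_singleton_iff.1 hx]
        exact hodd ho
      · exact hx.elim
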